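/- For every integer k with 1 ≤ k ≤ d−1, the point p(U_d^k) is a canonical vertex of the White Whale H_∞^+(d,1): it is an extreme point of H_∞^+(d,1), its first d−1 coordinates are all equal to ∑_{i=0}^{k−2} C(d−2, i), its last coordinate equals ∑_{i=0}^{k−1} C(d−1, i), and in particular its coordinates are nondecreasing. -/

import Mathlib

/-- The set `G_d` of generators of the White Whale:
all nonzero 0/1-valued vectors of `ℝ^d`. -/
def whaleGens (d : ℕ) : Set (Fin d → ℝ) :=
  {g | g ≠ 0 ∧ ∀ i, g i = 0 ∨ g i = 1}

/-- The point `p(S)`: the sum of the vectors in `S` (with `p(∅) = 0`). -/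
noncomputable def whaleSum {d : ℕ} (S : Set (Fin d → ℝ)) : Fin d → ℝ :=
  ∑ᶠ g ∈ S, g

/-- The White Whale `H_∞^+(d,1)`: the convex hull of the points `p(S)`
over all subsets `S ⊆ G_d`. -/
noncomputable def whiteWhale (d : ℕ) : Set (Fin d → ℝ) :=
  convexHull ℝ {x | ∃ S : Set (Fin d → ℝ), S ⊆ whaleGens d ∧ x = whaleSum S}

/-- A vertex of the White Whale is an extreme point of it. -/
def IsWhaleVertex (d : ℕ) (x : Fin d → ℝ) : Prop :=
  x ∈ Set.extremePoints ℝ (whiteWhale d)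

/-- The set U_d^k: vectors of G_d whose last coordinate is 1 and which have
at most k nonzero coordinates. -/
def whaleU (d k : ℕ) (hd : 0 < d) : Set (Fin d → ℝ) :=
  {g | g ∈ whaleGens d ∧ g ⟨d - 1, Nat.sub_lt hd one_pos⟩ = 1 ∧
       {i : Fin d | g i ≠ 0}.ncard ≤ k}

/-- The 0/1 vector with support `s`. -/
def whaleVec {d : ℕ} (s : Finset (Fin d)) : Fin d → ℝ :=
  fun i => if i ∈ s then 1 else 0

theorem whaleVec_injective {d : ℕ} : Function.Injective (whaleVec (d := d)) := by
  intro s t h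
  ext i
  have := congrFun h i
  by_cases hs : i ∈ s <;> by_cases ht : i ∈ t <;> simp_all [whaleVec]

theorem exists_whaleVec_eq {d : ℕ} {g : Fin d → ℝ} (hg : ∀ i, g i = 0 ∨ g i = 1) :
    ∃ s, whaleVec s = g := by
  classical
  refine ⟨Finset.univ.filter (fun i => g i = 1), ?_⟩
  ext i
  rcases hg i with h | h <;> simp [whaleVec, h]

theorem whaleVec_mem_whaleGens {d : ℕ} {s : Finset (Fin d)} (hs : s.Nonempty) :
    whaleVec s ∈ whaleGens d := by
  obtain ⟨i, hi⟩ := hs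
  refine ⟨fun h => ?_, fun j => ?_⟩
  · simpa [whaleVec, hi] using congrFun h i
  · by_cases hj : j ∈ s <;> simp [whaleVec, hj]

theorem whaleGens_finite (d : ℕ) : (whaleGens d).Finite :=
  (Set.finite_range (whaleVec (d := d))).subset fun _ hg => exists_whaleVec_eq hg.2

theorem ncard_support_whaleVec {d : ℕ} (s : Finset (Fin d)) :
    {i : Fin d | whaleVec s i ≠ 0}.ncard = s.card := by
  have : {i : Fin d | whaleVec s i ≠ 0} = (s : Set (Fin d)) := by
    ext i
    simp [whaleVec]
  rw [this, Set.ncard_coe_finset]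

theorem whaleU_eq_image (d k : ℕ) (hd : 0 < d) :
    whaleU d k hd = whaleVec ''
      ((Finset.univ.filter fun s : Finset (Fin d) =>
        ⟨d - 1, Nat.sub_lt hd one_pos⟩ ∈ s ∧ s.card ≤ k : Finset (Finset (Fin d))) :
        Set (Finset (Fin d))) := by
  ext g
  constructor
  · rintro ⟨hg, hl, hc⟩
    obtain ⟨s, rfl⟩ := exists_whaleVec_eq hg.2
    rw [ncard_support_whaleVec] at hc
    exact ⟨s, by simpa [whaleVec, hc] using hl, rfl⟩
  · rintro ⟨s, hs, rfl⟩
    obtain ⟨hl, hc⟩ : _ ∧ s.card ≤ k := by simpa using hs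
    exact ⟨whaleVec_mem_whaleGens ⟨_, hl⟩, by simp [whaleVec, hl],
      by rwa [ncard_support_whaleVec]⟩

theorem whaleSum_whaleU_apply (d k : ℕ) (hd : 0 < d) (i : Fin d) :
    whaleSum (whaleU d k hd) i =
      ((Finset.univ.filter fun s : Finset (Fin d) =>
        {i, ⟨d - 1, Nat.sub_lt hd one_pos⟩} ⊆ s ∧ s.card < k + 1).card : ℝ) := by
  rw [whaleSum, whaleU_eq_image, finsum_mem_image whaleVec_injective.injOn,
    finsum_mem_coe_finset, Finset.sum_apply]
  simp only [whaleVec]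
  rw [Finset.sum_boole, Finset.filter_filter]
  congr 2
  ext s
  simp only [Finset.mem_filter, Finset.insert_subset_iff, Finset.singleton_subset_iff]
  grind

/-- The number of supersets of `t` of cardinality less than `m`. -/
theorem card_filter_superset_card_lt {α : Type*} [Fintype α] [DecidableEq α]
    (t : Finset α) (m : ℕ) :
    (Finset.univ.filter fun s : Finset α => t ⊆ s ∧ s.card < m).card =
      ∑ j ∈ Finset.range (m - t.card), (Fintype.card α - t.card).choose j := by
  have h : ∀ j, (Fintype.card α - t.card).choose j = (Finset.powersetCard j tᶜ).card := by
    intro j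
    rw [Finset.card_powersetCard, Finset.card_compl]
  simp only [h]
  rw [← Finset.card_biUnion]
  · refine Finset.card_bij' (fun s _ => s \ t) (fun u _ => u ∪ t) ?_ ?_ ?_ ?_
    · intro s hs
      obtain ⟨hts, hc⟩ : t ⊆ s ∧ s.card < m := by simpa using hs
      have := Finset.card_sdiff_add_card_eq_card hts
      simp only [Finset.mem_biUnion, Finset.mem_range, Finset.mem_powersetCard]
      refine ⟨_, by omega, fun x hx => ?_, rfl⟩
      simp_all
    · intro u hu
      simp only [Finset.mem_biUnion, Finset.mem_range, Finset.mem_powersetCard] at hu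
      obtain ⟨j, hj, hut, rfl⟩ := hu
      have := Finset.card_union_le u t
      simp only [Finset.mem_filter, Finset.mem_univ, true_and]
      exact ⟨Finset.subset_union_right, by omega⟩
    · intro s hs
      exact Finset.sdiff_union_of_subset (by simp_all)
    · intro u hu
      simp only [Finset.mem_biUnion, Finset.mem_range, Finset.mem_powersetCard] at hu
      obtain ⟨j, hj, hut, rfl⟩ := hu
      exact Finset.union_sdiff_cancel_right
        (Finset.disjoint_left.2 fun x hx => by simpa using hut hx)
  · intro a _ b _ hab
    exact Finset.pairwise_disjoint_powersetCard _ hab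

theorem whaleSum_eq_sum_ite {d : ℕ} {S : Set (Fin d → ℝ)} (hS : S ⊆ whaleGens d)
    [DecidablePred (· ∈ S)] :
    whaleSum S = ∑ g ∈ (whaleGens_finite d).toFinset, if g ∈ S then g else 0 := by
  rw [whaleSum, ← Finset.sum_filter, ← finsum_mem_coe_finset]
  congr! 3 with g
  simpa using fun h => hS h

/-- If a linear functional vanishes on no generator, the sum of the generators on which it is
positive is a vertex. -/
theorem isWhaleVertex_of_pos {d : ℕ} {S : Set (Fin d → ℝ)} (hS : S ⊆ whaleGens d)
    (φ : StrongDual ℝ (Fin d → ℝ)) (hpos : ∀ g ∈ S, 0 < φ g)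
    (hneg : ∀ g ∈ whaleGens d, g ∉ S → φ g < 0) : IsWhaleVertex d (whaleSum S) := by
  classical
  apply exposedPoints_subset_extremePoints
  refine ⟨subset_convexHull ℝ _ ⟨S, hS, rfl⟩, φ, ?_⟩
  have key : ∀ T ⊆ whaleGens d,
      φ (whaleSum T) < φ (whaleSum S) ∨ whaleSum T = whaleSum S := by
    intro T hT
    have hle : ∀ g ∈ (whaleGens_finite d).toFinset,
        φ (if g ∈ T then g else 0) ≤ φ (if g ∈ S then g else 0) := by
      intro g hg
      have h1 := hpos g
      have h2 := hneg g (by simpa using hg)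
      split_ifs <;> simp_all [le_of_lt]
    rcases (Finset.sum_le_sum hle).lt_or_eq with h | h
    · left
      rwa [whaleSum_eq_sum_ite hT, whaleSum_eq_sum_ite hS, map_sum, map_sum]
    · right
      rw [whaleSum_eq_sum_ite hT, whaleSum_eq_sum_ite hS]
      refine Finset.sum_congr rfl fun g hg => ?_
      have h0 := (Finset.sum_eq_sum_iff_of_le hle).1 h g hg
      have h1 := hpos g
      have h2 := hneg g (by simpa using hg)
      split_ifs at h0 ⊢ with hgT hgS hgS
      · rfl
      · exact absurd h0 (by simpa using (h2 hgS).ne)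
      · exact absurd h0 (by simpa using (h1 hgS).ne)
      · rfl
  have hconv : Convex ℝ {y | φ y < φ (whaleSum S) ∨ y = whaleSum S} := by
    intro x hx y hy a b ha hb hab
    have hxle : φ x ≤ φ (whaleSum S) := by rcases hx with h | rfl; exacts [h.le, le_rfl]
    have hyle : φ y ≤ φ (whaleSum S) := by rcases hy with h | rfl; exacts [h.le, le_rfl]
    rcases ha.eq_or_lt with rfl | ha
    · obtain rfl : b = 1 := by linarith
      simpa using hy
    rcases hb.eq_or_lt with rfl | hb
    · obtain rfl : a = 1 := by linarith
      simpa using hx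
    have hM : φ (whaleSum S) = a * φ (whaleSum S) + b * φ (whaleSum S) := by
      rw [← add_mul, hab, one_mul]
    rcases hx with h | rfl
    · left
      simp only [map_add, map_smul, smul_eq_mul]
      nlinarith [mul_lt_mul_of_pos_left h ha, mul_le_mul_of_nonneg_left hyle hb.le]
    rcases hy with h | rfl
    · left
      simp only [map_add, map_smul, smul_eq_mul]
      nlinarith [mul_lt_mul_of_pos_left h hb]
    · right
      rw [← add_smul, hab, one_smul]
  intro y hy
  have hy' : φ y < φ (whaleSum S) ∨ y = whaleSum S :=
    convexHull_min (by rintro _ ⟨T, hT, rfl⟩; exact key T hT) hconv hy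
  rcases hy' with h | rfl
  · exact ⟨h.le, fun h' => absurd h h'.not_gt⟩
  · exact ⟨le_rfl, fun _ => rfl⟩

theorem isWhaleVertex_whaleSum_whaleU (d k : ℕ) (hd : 0 < d) :
    IsWhaleVertex d (whaleSum (whaleU d k hd)) := by
  set l : Fin d := ⟨d - 1, Nat.sub_lt hd one_pos⟩ with hl
  let φ : StrongDual ℝ (Fin d → ℝ) :=
    ((k : ℝ) + 1 / 2) • ContinuousLinearMap.proj l - ∑ i, ContinuousLinearMap.proj i
  have hφ : ∀ s : Finset (Fin d),
      φ (whaleVec s) = (if l ∈ s then (k : ℝ) + 1 / 2 else 0) - s.card := by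
    intro s
    simp [φ, whaleVec]
  refine isWhaleVertex_of_pos (fun g hg => hg.1) φ ?_ ?_
  · rw [whaleU_eq_image]
    rintro _ ⟨s, hs, rfl⟩
    obtain ⟨hls, hc⟩ : l ∈ s ∧ s.card ≤ k := by simpa using hs
    have : (s.card : ℝ) ≤ k := by exact_mod_cast hc
    rw [hφ, if_pos hls]
    linarith
  · intro g hg hgU
    obtain ⟨s, rfl⟩ := exists_whaleVec_eq hg.2
    rw [hφ]
    split_ifs with hls
    · have hc : k + 1 ≤ s.card := by
        by_contra hc
        refine hgU ⟨hg, by simp [whaleVec, ← hl, hls], ?_⟩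
        rw [ncard_support_whaleVec]
        omega
      have : (k : ℝ) + 1 ≤ s.card := by exact_mod_cast hc
      linarith
    · have hs : s.Nonempty := by
        rw [Finset.nonempty_iff_ne_empty]
        rintro rfl
        exact hg.1 (by ext; simp [whaleVec])
      have : (0 : ℝ) < s.card := by exact_mod_cast hs.card_pos
      linarith

/-- p(U_d^k) is a canonical vertex of the White Whale: it is an extreme point,
its first d−1 coordinates equal ∑_{i=0}^{k−2} C(d−2,i), its last coordinate
equals ∑_{i=0}^{k−1} C(d−1,i), and its coordinates are nondecreasing. -/
theorem whaleU_sum_is_canonical_vertex (d k : ℕ) (hd : 2 ≤ d)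
    (hk1 : 1 ≤ k) (hk2 : k ≤ d - 1) :
    IsWhaleVertex d (whaleSum (whaleU d k (by omega))) ∧
    (∀ i : Fin d, (i : ℕ) < d - 1 →
      whaleSum (whaleU d k (by omega)) i =
        ((∑ j ∈ Finset.range (k - 1), (d - 2).choose j : ℕ) : ℝ)) ∧
    whaleSum (whaleU d k (by omega)) ⟨d - 1, by omega⟩ =
      ((∑ j ∈ Finset.range k, (d - 1).choose j : ℕ) : ℝ) ∧
    Monotone (whaleSum (whaleU d k (by omega))) := by
  have hfirst : ∀ i : Fin d, (i : ℕ) < d - 1 →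
      whaleSum (whaleU d k (by omega)) i =
        ((∑ j ∈ Finset.range (k - 1), (d - 2).choose j : ℕ) : ℝ) := by
    intro i hi
    have hne : i ≠ ⟨d - 1, by omega⟩ := fun h => hi.ne (congrArg Fin.val h)
    rw [whaleSum_whaleU_apply, card_filter_superset_card_lt, Finset.card_pair hne,
      Fintype.card_fin]
    rfl
  have hlast : whaleSum (whaleU d k (by omega)) ⟨d - 1, by omega⟩ =
      ((∑ j ∈ Finset.range k, (d - 1).choose j : ℕ) : ℝ) := by
    rw [whaleSum_whaleU_apply, card_filter_superset_card_lt, Finset.pair_eq_singleton,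
      Finset.card_singleton, Fintype.card_fin]
    rfl
  refine ⟨isWhaleVertex_whaleSum_whaleU d k _, hfirst, hlast, fun i j hij => ?_⟩
  have eq_last : ∀ m : Fin d, ¬ (m : ℕ) < d - 1 → m = ⟨d - 1, by omega⟩ :=
    fun m hm => Fin.ext (by have := m.isLt; simp only; omega)
  by_cases hj : (j : ℕ) < d - 1
  · rw [hfirst j hj, hfirst i (lt_of_le_of_lt hij hj)]
  rw [eq_last j hj]
  by_cases hi : (i : ℕ) < d - 1
  · rw [hfirst i hi, hlast, Nat.cast_le]
    calc ∑ m ∈ Finset.range (k - 1), (d - 2).choose m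
        ≤ ∑ m ∈ Finset.range (k - 1), (d - 1).choose m :=
          Finset.sum_le_sum fun m _ => Nat.choose_le_choose m (by omega)
      _ ≤ ∑ m ∈ Finset.range k, (d - 1).choose m :=
          Finset.sum_le_sum_of_subset (Finset.range_mono (by omega))
  · rw [eq_last i hi]
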